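/- arXiv:1704.08281 — 3 statements merged into one kernel-verified Lean document; each statement's English description precedes it below -/
import Mathlib

section
/- For every positive integer N, for Lebesgue almost every x ∈ [0,1), the N-continued fraction convergents A_n/B_n of x satisfy lim_{n→∞} −(1/n) ln|x − A_n/B_n| = 2Λ_N + ln N, where Λ_N = Θ(1/N)/ln(1+1/N) and Θ(x) = ∫_0^x ln(1+t)/t dt. -/
open MeasureTheory Filter Set

/-- The generalized Gauss transformation `T_N(x) = {N/x}` (and `T_N(0) = 0`). -/
noncomputable def gaussT (N : ℕ) (x : ℝ) : ℝ :=
  if x = 0 then 0 else Int.fract ((N : ℝ) / x)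

/-- The numerators of the `N`-continued fraction convergents of `x`:
`gaussA N x (n+1)` stands for `A_n`, with `A_{-1} = 1`, `A_0 = 0` and
`A_n = a_n A_{n-1} + N A_{n-2}`, where `a_k = ⌊N / T_N^[k-1] x⌋`. -/
noncomputable def gaussA (N : ℕ) (x : ℝ) : ℕ → ℤ
  | 0 => 1
  | 1 => 0
  | (n + 2) => ⌊(N : ℝ) / (gaussT N)^[n] x⌋ * gaussA N x (n + 1) + N * gaussA N x n

/-- The denominators of the `N`-continued fraction convergents of `x`:
`gaussB N x (n+1)` stands for `B_n`, with `B_{-1} = 0`, `B_0 = 1` and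
`B_n = a_n B_{n-1} + N B_{n-2}`, where `a_k = ⌊N / T_N^[k-1] x⌋`. -/
noncomputable def gaussB (N : ℕ) (x : ℝ) : ℕ → ℤ
  | 0 => 0
  | 1 => 1
  | (n + 2) => ⌊(N : ℝ) / (gaussT N)^[n] x⌋ * gaussB N x (n + 1) + N * gaussB N x n

/-- The dilogarithm-type function `Θ(x) = ∫_0^x log(1+t)/t dt`. -/
noncomputable def dilogTheta (x : ℝ) : ℝ :=
  ∫ t in (0:ℝ)..x, Real.log (1 + t) / t

/-- The constant `Λ_N = Θ(1/N) / log(1 + 1/N)`. -/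
noncomputable def gaussLambda (N : ℕ) : ℝ :=
  dilogTheta (1 / (N : ℝ)) / Real.log (1 + 1 / (N : ℝ))

/-- The invariant weight of the `k`-th inverse branch of the Gauss map at `x`. -/
noncomputable def gaussWeight (N k : ℕ) (x : ℝ) : ℝ :=
  (N + x) / ((N + k + x) * (N + k + x + 1))

/-- The `k`-th inverse branch of the Gauss map. -/
noncomputable def gaussBranch (N k : ℕ) (x : ℝ) : ℝ := N / (N + k + x)

/-- The transfer operator of the Gauss map with respect to its invariant measure. -/
noncomputable def gaussTransfer (N : ℕ) (f : ℝ → ℝ) (x : ℝ) : ℝ :=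
  ∑' k, gaussWeight N k x * f (gaussBranch N k x)

lemma gaussWeight_nonneg (N k : ℕ) {x : ℝ} (hx : 0 ≤ x) : 0 ≤ gaussWeight N k x := by
  unfold gaussWeight; positivity

lemma gaussBranch_mem {N : ℕ} (hN : 0 < N) (k : ℕ) {x : ℝ} (hx : 0 ≤ x) :
    gaussBranch N k x ∈ Ioc (0 : ℝ) 1 := by
  have : (0 : ℝ) < N := by exact_mod_cast hN
  unfold gaussBranch
  refine ⟨by positivity, ?_⟩
  rw [div_le_one (by positivity)]
  have : (0 : ℝ) ≤ k := by positivity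
  linarith

lemma hasSum_gaussWeight {N : ℕ} (hN : 0 < N) {x : ℝ} (hx : 0 ≤ x) :
    HasSum (fun k => gaussWeight N k x) 1 := by
  have hN' : (0 : ℝ) < N := by exact_mod_cast hN
  rw [hasSum_iff_tendsto_nat_of_nonneg (fun k => gaussWeight_nonneg N k hx)]
  have hsum : ∀ n : ℕ, ∑ k ∈ Finset.range n, gaussWeight N k x
      = 1 - (N + x) / (N + n + x) := by
    intro n
    induction n with
    | zero =>
      have : (N : ℝ) + x ≠ 0 := by positivity
      simp [this]
    | succ n ih =>
      rw [Finset.sum_range_succ, ih, gaussWeight]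
      push_cast
      have h1 : (N : ℝ) + n + x ≠ 0 := by positivity
      have h2 : (N : ℝ) + n + x + 1 ≠ 0 := by positivity
      have h3 : (N : ℝ) + (n + 1) + x ≠ 0 := by positivity
      field_simp
      ring
  simp_rw [hsum]
  have : Tendsto (fun n : ℕ => (N + x) / ((N : ℝ) + n + x)) atTop (nhds 0) := by
    apply Tendsto.div_atTop tendsto_const_nhds
    apply tendsto_atTop_add_const_right
    exact tendsto_atTop_add_const_left _ _ tendsto_natCast_atTop_atTop
  simpa using this.const_sub 1

lemma gaussWeight_le_two_mul {N : ℕ} (hN : 0 < N) (k : ℕ) {x y : ℝ} (hx : 0 ≤ x) (hxy : x ≤ y)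
    (hy : y ≤ 1) : gaussWeight N k y ≤ 2 * gaussWeight N k x := by
  have hN' : (1 : ℝ) ≤ N := by exact_mod_cast hN
  have hy0 := hx.trans hxy
  unfold gaussWeight
  rw [← mul_div_assoc]
  gcongr
  linarith

/-- As `x` grows, the weights move mass towards larger indices, with a single crossing. -/
lemma gaussWeight_crossing {N : ℕ} (hN : 0 < N) {x y : ℝ} (hx : 0 ≤ x) (hxy : x ≤ y)
    (hy : y ≤ 1) : ∃ c : ℕ, (∀ k < c, gaussWeight N k y ≤ gaussWeight N k x) ∧
      ∀ k, c ≤ k → gaussWeight N k x ≤ gaussWeight N k y := by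
  have hN' : (1 : ℝ) ≤ N := by exact_mod_cast hN
  set b : ℕ → ℝ := fun k => ((N : ℝ) + k) ^ 2 + (N + k) - x * y - N * (2 * (N + k) + x + y + 1)
    with hb
  have key : ∀ k, gaussWeight N k y - gaussWeight N k x
      = (y - x) * b k / (((N + k + x) * (N + k + x + 1)) * ((N + k + y) * (N + k + y + 1))) := by
    intro k
    have hk : (0 : ℝ) ≤ k := by positivity
    have h1 : (N : ℝ) + k + x ≠ 0 := by positivity
    have h2 : (N : ℝ) + k + x + 1 ≠ 0 := by positivity
    have h3 : (N : ℝ) + k + y ≠ 0 := by have := hx.trans hxy; positivity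
    have h4 : (N : ℝ) + k + y + 1 ≠ 0 := by have := hx.trans hxy; positivity
    simp only [hb, gaussWeight]
    field_simp
    ring
  have hy0 := hx.trans hxy
  have hxy1 : x * y ≤ 1 := by nlinarith
  have hex : ∃ k, 0 ≤ b k := by
    refine ⟨N + 2, ?_⟩
    simp only [hb]
    push_cast
    nlinarith
  classical
  refine ⟨Nat.find hex, fun k hk => ?_, fun k hk => ?_⟩
  · have h := Nat.find_min hex hk
    rw [← sub_nonpos, key]
    apply div_nonpos_of_nonpos_of_nonneg _ (by positivity)
    exact mul_nonpos_of_nonneg_of_nonpos (by linarith) (by linarith)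
  · have h := Nat.find_spec hex
    rw [← sub_nonneg, key]
    have hk' : ((Nat.find hex : ℕ) : ℝ) ≤ k := by exact_mod_cast hk
    have : 0 ≤ b k := by
      simp only [hb] at h ⊢
      set c : ℝ := ((Nat.find hex : ℕ) : ℝ)
      have hc : (0 : ℝ) ≤ c := by positivity
      have hxy0 : 0 ≤ x * y := by positivity
      have hNc : (N : ℝ) ≤ c + 1 := by
        by_contra hcon
        push Not at hcon
        nlinarith [mul_nonneg hc (by linarith : (0 : ℝ) ≤ N - c), mul_nonneg hx (by linarith : (0 : ℝ) ≤ N), mul_nonneg hy0 (by linarith : (0 : ℝ) ≤ N)]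
      nlinarith [mul_nonneg (sub_nonneg.2 hk') hc, mul_nonneg (sub_nonneg.2 hk') (sub_nonneg.2 hk')]
    have : 0 ≤ (y - x) * b k := mul_nonneg (by linarith) this
    positivity

lemma gaussTransfer_antitoneOn {N : ℕ} (hN : 0 < N) {f : ℝ → ℝ} (hf : MonotoneOn f (Ioc 0 1))
    (hs : ∀ x ∈ Icc (0 : ℝ) 1, Summable fun k => gaussWeight N k x * f (gaussBranch N k x)) :
    AntitoneOn (gaussTransfer N f) (Icc 0 1) := by
  have hN' : (0 : ℝ) < N := by exact_mod_cast hN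
  intro x hx y hy hxy
  obtain ⟨c, hc1, hc2⟩ := gaussWeight_crossing hN hx.1 hxy hy.2
  have hmix : Summable fun k => gaussWeight N k y * f (gaussBranch N k x) := by
    refine Summable.of_norm_bounded ((hs x hx).norm.mul_left 2) fun k => ?_
    rw [norm_mul, norm_mul, ← mul_assoc]
    gcongr
    rw [Real.norm_of_nonneg (gaussWeight_nonneg N k hy.1),
      Real.norm_of_nonneg (gaussWeight_nonneg N k hx.1)]
    exact gaussWeight_le_two_mul hN k hx.1 hxy hy.2
  have h1 : gaussTransfer N f y ≤ ∑' k, gaussWeight N k y * f (gaussBranch N k x) := by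
    refine (hs y hy).tsum_le_tsum (fun k => ?_) hmix
    refine mul_le_mul_of_nonneg_left ?_ (gaussWeight_nonneg N k hy.1)
    refine hf (gaussBranch_mem hN k hy.1) (gaussBranch_mem hN k hx.1) ?_
    have := hx.1
    unfold gaussBranch
    gcongr
  refine h1.trans ?_
  set v := f (gaussBranch N c x)
  have hwy := (hasSum_gaussWeight hN hy.1).mul_right v
  have hwx := (hasSum_gaussWeight hN hx.1).mul_right v
  have h2 : ∑' k, (gaussWeight N k y * f (gaussBranch N k x) - gaussWeight N k y * v)
      ≤ ∑' k, (gaussWeight N k x * f (gaussBranch N k x) - gaussWeight N k x * v) := by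
    refine (hmix.sub hwy.summable).tsum_le_tsum (fun k => ?_) ((hs x hx).sub hwx.summable)
    rcases lt_or_ge k c with hk | hk
    · have : v ≤ f (gaussBranch N k x) := by
        refine hf (gaussBranch_mem hN c hx.1) (gaussBranch_mem hN k hx.1) ?_
        have := hx.1
        unfold gaussBranch
        gcongr
      nlinarith [hc1 k hk]
    · have : f (gaussBranch N k x) ≤ v := by
        refine hf (gaussBranch_mem hN k hx.1) (gaussBranch_mem hN c hx.1) ?_
        have := hx.1
        unfold gaussBranch
        gcongr
      nlinarith [hc2 k hk]
  rw [hmix.tsum_sub hwy.summable, (hs x hx).tsum_sub hwx.summable, hwy.tsum_eq, hwx.tsum_eq] at h2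
  unfold gaussTransfer
  linarith

lemma gaussTransfer_neg (N : ℕ) (f : ℝ → ℝ) (x : ℝ) :
    gaussTransfer N (-f) x = -gaussTransfer N f x := by
  simp [gaussTransfer, tsum_neg]

lemma gaussTransfer_monotoneOn {N : ℕ} (hN : 0 < N) {f : ℝ → ℝ} (hf : AntitoneOn f (Ioc 0 1))
    (hs : ∀ x ∈ Icc (0 : ℝ) 1, Summable fun k => gaussWeight N k x * f (gaussBranch N k x)) :
    MonotoneOn (gaussTransfer N f) (Icc 0 1) := by
  have h : AntitoneOn (gaussTransfer N (-f)) (Icc 0 1) := gaussTransfer_antitoneOn hN hf.neg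
    (fun x hx => by simpa using (hs x hx).neg)
  intro x hx y hy hxy
  have := h hx hy hxy
  rw [gaussTransfer_neg, gaussTransfer_neg] at this
  linarith

lemma gaussTransfer_zero_sub_one {N : ℕ} (hN : 0 < N) {f : ℝ → ℝ}
    (hs : ∀ x ∈ Icc (0 : ℝ) 1, Summable fun k => gaussWeight N k x * f (gaussBranch N k x)) :
    gaussTransfer N f 0 - gaussTransfer N f 1 = (f 1 - gaussTransfer N f 1) / (N + 1) := by
  have hN' : (0 : ℝ) < N := by exact_mod_cast hN
  have h : ∀ k, gaussWeight N (k + 1) 0 * f (gaussBranch N (k + 1) 0)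
      = N / (N + 1) * (gaussWeight N k 1 * f (gaussBranch N k 1)) := by
    intro k
    have e : gaussBranch N (k + 1) 0 = gaussBranch N k 1 := by
      simp [gaussBranch, add_assoc]
    rw [e, ← mul_assoc]
    congr 1
    unfold gaussWeight
    push_cast
    field_simp
    ring
  have h0 : gaussTransfer N f 0 = 1 / (N + 1) * f 1 + N / (N + 1) * gaussTransfer N f 1 := by
    unfold gaussTransfer
    rw [(hs 0 (by simp)).tsum_eq_zero_add]
    simp_rw [h]
    rw [tsum_mul_left]
    congr 2
    · simp [gaussWeight]; field_simp
    · simp [gaussBranch, hN'.ne']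
  rw [h0]
  field_simp
  ring

lemma summable_gaussTransfer {N : ℕ} (hN : 0 < N) {f : ℝ → ℝ} {C : ℝ}
    (hf : ∀ x ∈ Icc (0 : ℝ) 1, |f x| ≤ C) {x : ℝ} (hx : x ∈ Icc (0 : ℝ) 1) :
    Summable fun k => gaussWeight N k x * f (gaussBranch N k x) := by
  refine Summable.of_norm_bounded ((hasSum_gaussWeight hN hx.1).summable.mul_right C) fun k => ?_
  rw [norm_mul, Real.norm_of_nonneg (gaussWeight_nonneg N k hx.1)]
  exact mul_le_mul_of_nonneg_left (hf _ (Ioc_subset_Icc_self (gaussBranch_mem hN k hx.1)))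
    (gaussWeight_nonneg N k hx.1)

lemma le_gaussTransfer {N : ℕ} (hN : 0 < N) {f : ℝ → ℝ} {C : ℝ} {x : ℝ}
    (hx : x ∈ Icc (0 : ℝ) 1) (hf : ∀ y ∈ Icc (0 : ℝ) 1, C ≤ f y)
    (hs : Summable fun k => gaussWeight N k x * f (gaussBranch N k x)) :
    C ≤ gaussTransfer N f x := by
  have h := (hasSum_gaussWeight hN hx.1).mul_right C
  rw [one_mul] at h
  exact hasSum_le (fun k => mul_le_mul_of_nonneg_left
    (hf _ (Ioc_subset_Icc_self (gaussBranch_mem hN k hx.1))) (gaussWeight_nonneg N k hx.1)) h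
    hs.hasSum

/-- Functions that are monotone or antitone on the unit interval. -/
def UnitMonotone (f : ℝ → ℝ) : Prop := MonotoneOn f (Icc 0 1) ∨ AntitoneOn f (Icc 0 1)

lemma UnitMonotone.abs_le {f : ℝ → ℝ} (hf : UnitMonotone f) {x : ℝ} (hx : x ∈ Icc (0 : ℝ) 1) :
    |f x| ≤ max |f 0| |f 1| := by
  have h0 : (0 : ℝ) ∈ Icc (0 : ℝ) 1 := by simp
  have h1 : (1 : ℝ) ∈ Icc (0 : ℝ) 1 := by simp
  rcases hf with hf | hf
  · exact abs_le_max_abs_abs (hf h0 hx hx.1) (hf hx h1 hx.2)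
  · rw [max_comm]
    exact abs_le_max_abs_abs (hf hx h1 hx.2) (hf h0 hx hx.1)

lemma UnitMonotone.le_add {f : ℝ → ℝ} (hf : UnitMonotone f) {x y : ℝ} (hx : x ∈ Icc (0 : ℝ) 1)
    (hy : y ∈ Icc (0 : ℝ) 1) : f x ≤ f y + |f 0 - f 1| := by
  have h0 : (0 : ℝ) ∈ Icc (0 : ℝ) 1 := by simp
  have h1 : (1 : ℝ) ∈ Icc (0 : ℝ) 1 := by simp
  rcases hf with hf | hf
  · have := neg_le_abs (f 0 - f 1)
    linarith [hf hx h1 hx.2, hf h0 hy hy.1]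
  · have := le_abs_self (f 0 - f 1)
    linarith [hf hy h1 hy.2, hf h0 hx hx.1]

lemma UnitMonotone.gaussTransfer {N : ℕ} (hN : 0 < N) {f : ℝ → ℝ} (hf : UnitMonotone f) :
    UnitMonotone (gaussTransfer N f) := by
  have hs := fun x (hx : x ∈ Icc (0 : ℝ) 1) =>
    summable_gaussTransfer hN (fun y hy => hf.abs_le hy) hx
  rcases hf with hf | hf
  · exact Or.inr (gaussTransfer_antitoneOn hN (hf.mono Ioc_subset_Icc_self) hs)
  · exact Or.inl (gaussTransfer_monotoneOn hN (hf.mono Ioc_subset_Icc_self) hs)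

/-- The transfer operator halves the oscillation of monotone functions. -/
lemma UnitMonotone.abs_gaussTransfer_sub_le {N : ℕ} (hN : 0 < N) {f : ℝ → ℝ}
    (hf : UnitMonotone f) :
    |_root_.gaussTransfer N f 0 - _root_.gaussTransfer N f 1| ≤ |f 0 - f 1| / 2 := by
  have hN' : (1 : ℝ) ≤ N := by exact_mod_cast hN
  have hs := fun x (hx : x ∈ Icc (0 : ℝ) 1) =>
    summable_gaussTransfer hN (fun y hy => hf.abs_le hy) hx
  have h0 : (0 : ℝ) ∈ Icc (0 : ℝ) 1 := by simp
  have h1 : (1 : ℝ) ∈ Icc (0 : ℝ) 1 := by simp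
  rw [gaussTransfer_zero_sub_one hN hs, abs_div, abs_of_pos (by positivity : (0 : ℝ) < N + 1)]
  have : |f 1 - _root_.gaussTransfer N f 1| ≤ |f 0 - f 1| := by
    rcases hf with hf | hf
    · have ha := le_gaussTransfer hN h1 (fun y hy => hf h0 hy hy.1) (hs 1 h1)
      have hb := le_gaussTransfer (f := -f) hN h1 (fun y hy => neg_le_neg (hf hy h1 hy.2))
        (by simpa using (hs 1 h1).neg)
      rw [gaussTransfer_neg] at hb
      rw [abs_sub_comm (f 0), abs_of_nonneg (by linarith), abs_of_nonneg (by linarith)]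
      linarith
    · have ha := le_gaussTransfer hN h1 (fun y hy => hf hy h1 hy.2) (hs 1 h1)
      have hb := le_gaussTransfer (f := -f) hN h1 (fun y hy => neg_le_neg (hf h0 hy hy.1))
        (by simpa using (hs 1 h1).neg)
      rw [gaussTransfer_neg] at hb
      rw [abs_sub_comm (f 1), abs_of_nonneg (by linarith), abs_of_nonneg (by linarith)]
      linarith
  gcongr
  linarith

lemma measurable_gaussT (N : ℕ) : Measurable (gaussT N) :=
  Measurable.ite (measurableSet_singleton 0) measurable_const
    (measurable_fract.comp (measurable_const.div measurable_id))

lemma div_gaussBranch {N : ℕ} (hN : 0 < N) (k : ℕ) {x : ℝ} (hx : 0 ≤ x) :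
    (N : ℝ) / gaussBranch N k x = ((N + k : ℕ) : ℝ) + x := by
  have hN' : (0 : ℝ) < N := by exact_mod_cast hN
  have : (N : ℝ) + k + x ≠ 0 := by positivity
  unfold gaussBranch
  push_cast
  field_simp

lemma gaussT_gaussBranch {N : ℕ} (hN : 0 < N) (k : ℕ) {x : ℝ} (hx : x ∈ Ico (0 : ℝ) 1) :
    gaussT N (gaussBranch N k x) = x := by
  rw [gaussT, if_neg (gaussBranch_mem hN k hx.1).1.ne', div_gaussBranch hN k hx.1,
    Int.fract_natCast_add, Int.fract_eq_self.2 hx]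

lemma floor_div_gaussBranch {N : ℕ} (hN : 0 < N) (k : ℕ) {x : ℝ} (hx : x ∈ Ico (0 : ℝ) 1) :
    ⌊(N : ℝ) / gaussBranch N k x⌋ = ((N + k : ℕ) : ℤ) := by
  rw [div_gaussBranch hN k hx.1, Int.floor_natCast_add, Int.floor_eq_zero_iff.2 hx, add_zero]

lemma injOn_gaussBranch {N : ℕ} (hN : 0 < N) (k : ℕ) : InjOn (gaussBranch N k) (Ico 0 1) := by
  intro x hx y hy h
  rw [← gaussT_gaussBranch hN k hx, h, gaussT_gaussBranch hN k hy]

lemma hasDerivAt_gaussBranch {N : ℕ} (hN : 0 < N) (k : ℕ) {x : ℝ} (hx : 0 ≤ x) :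
    HasDerivAt (gaussBranch N k) (-N / (N + k + x) ^ 2) x := by
  have hN' : (0 : ℝ) < N := by exact_mod_cast hN
  have h0 : (N : ℝ) + k + x ≠ 0 := by positivity
  have h := (hasDerivAt_const x (N : ℝ)).div ((hasDerivAt_id x).const_add ((N : ℝ) + k)) h0
  refine h.congr_deriv ?_
  simp

lemma iUnion_gaussBranch_image {N : ℕ} (hN : 0 < N) :
    ⋃ k, gaussBranch N k '' Ico 0 1 = Ioc 0 1 := by
  have hN' : (0 : ℝ) < N := by exact_mod_cast hN
  ext x
  simp only [mem_iUnion, mem_image]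
  constructor
  · rintro ⟨k, y, hy, rfl⟩
    exact gaussBranch_mem hN k hy.1
  · intro hx
    have hle : (N : ℝ) ≤ N / x := by
      rw [le_div_iff₀ hx.1]
      nlinarith [hx.2]
    have hfl : (N : ℤ) ≤ ⌊(N : ℝ) / x⌋ := Int.le_floor.2 (by exact_mod_cast hle)
    obtain ⟨k, hk⟩ := Int.le.dest hfl
    refine ⟨k, Int.fract ((N : ℝ) / x), ⟨Int.fract_nonneg _, Int.fract_lt_one _⟩, ?_⟩
    have : (N : ℝ) + k = ⌊(N : ℝ) / x⌋ := by exact_mod_cast hk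
    unfold gaussBranch
    rw [this, Int.floor_add_fract]
    field_simp [hx.1.ne']

lemma pairwise_disjoint_gaussBranch_image {N : ℕ} (hN : 0 < N) :
    Pairwise (Function.onFun Disjoint fun k => gaussBranch N k '' Ico (0 : ℝ) 1) := by
  intro i j hij
  rw [Function.onFun, Set.disjoint_left]
  rintro _ ⟨x, hx, rfl⟩ ⟨y, hy, h⟩
  have := floor_div_gaussBranch hN j hy
  rw [h, floor_div_gaussBranch hN i hx] at this
  omega

/-- The density of the invariant probability measure of the Gauss map. -/
noncomputable def gaussDensity (N : ℕ) (x : ℝ) : ℝ :=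
  1 / (Real.log (1 + 1 / N) * (N + x))

/-- The invariant probability measure of the Gauss map. -/
noncomputable def gaussMeasure (N : ℕ) : Measure ℝ :=
  (volume.restrict (Ioc 0 1)).withDensity fun x => ENNReal.ofReal (gaussDensity N x)

lemma log_one_add_inv_pos {N : ℕ} (hN : 0 < N) : 0 < Real.log (1 + 1 / N) := by
  have hN' : (0 : ℝ) < N := by exact_mod_cast hN
  apply Real.log_pos
  have : (0 : ℝ) < 1 / N := by positivity
  linarith

lemma gaussDensity_pos {N : ℕ} (hN : 0 < N) {x : ℝ} (hx : 0 ≤ x) : 0 < gaussDensity N x := by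
  have := log_one_add_inv_pos hN
  unfold gaussDensity
  positivity

lemma measurable_gaussDensity (N : ℕ) : Measurable (gaussDensity N) := by
  unfold gaussDensity
  fun_prop

lemma lintegral_gaussMeasure (N : ℕ) (G : ℝ → ENNReal) :
    ∫⁻ x, G x ∂gaussMeasure N = ∫⁻ x in Ioc 0 1, ENNReal.ofReal (gaussDensity N x) * G x := by
  rw [gaussMeasure, lintegral_withDensity_eq_lintegral_mul_non_measurable₀]
  · rfl
  · exact (measurable_gaussDensity N).ennreal_ofReal.aemeasurable
  · exact ae_of_all _ fun x => ENNReal.ofReal_lt_top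

lemma gaussDensity_gaussBranch {N : ℕ} (hN : 0 < N) (k : ℕ) {x : ℝ} (hx : 0 ≤ x) :
    N / (N + k + x) ^ 2 * gaussDensity N (gaussBranch N k x)
      = gaussDensity N x * gaussWeight N k x := by
  have hN' : (0 : ℝ) < N := by exact_mod_cast hN
  have := (log_one_add_inv_pos hN).ne'
  have h0 : (N : ℝ) + k + x ≠ 0 := by positivity
  unfold gaussDensity gaussBranch gaussWeight
  generalize Real.log (1 + 1 / N) = c at *
  field_simp

/-- Duality between composition with the Gauss map and the transfer operator. -/
lemma lintegral_comp_gaussT_mul {N : ℕ} (hN : 0 < N) {f : ℝ → ℝ} (hf0 : ∀ x ∈ Ioc (0 : ℝ) 1, 0 ≤ f x)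
    (hf : MonotoneOn f (Ioc 0 1) ∨ AntitoneOn f (Ioc 0 1))
    (hs : ∀ x ∈ Icc (0 : ℝ) 1, Summable fun k => gaussWeight N k x * f (gaussBranch N k x))
    {G : ℝ → ENNReal} (hG : Measurable G) :
    ∫⁻ x, G (gaussT N x) * ENNReal.ofReal (f x) ∂gaussMeasure N
      = ∫⁻ x, G x * ENNReal.ofReal (gaussTransfer N f x) ∂gaussMeasure N := by
  have hN' : (0 : ℝ) < N := by exact_mod_cast hN
  rw [lintegral_gaussMeasure, lintegral_gaussMeasure, ← iUnion_gaussBranch_image hN,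
    lintegral_iUnion _ (pairwise_disjoint_gaussBranch_image hN), iUnion_gaussBranch_image hN]
  swap
  · intro k
    refine measurableSet_Ico.image_of_continuousOn_injOn (fun x hx => ?_) (injOn_gaussBranch hN k)
    exact (hasDerivAt_gaussBranch hN k hx.1).continuousAt.continuousWithinAt
  have hbr : ∀ k, ∫⁻ x in gaussBranch N k '' Ico 0 1,
      ENNReal.ofReal (gaussDensity N x) * (G (gaussT N x) * ENNReal.ofReal (f x))
      = ∫⁻ x in Ico 0 1, ENNReal.ofReal (gaussDensity N x) * (G x *
          ENNReal.ofReal (gaussWeight N k x * f (gaussBranch N k x))) := by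
    intro k
    rw [lintegral_image_eq_lintegral_abs_deriv_mul measurableSet_Ico
      (fun x hx => (hasDerivAt_gaussBranch hN k hx.1).hasDerivWithinAt) (injOn_gaussBranch hN k)]
    refine setLIntegral_congr_fun measurableSet_Ico fun x hx => ?_
    have h1 : |-(N : ℝ) / (N + k + x) ^ 2| = N / (N + k + x) ^ 2 := by
      rw [neg_div, abs_neg, abs_of_nonneg (by positivity)]
    rw [gaussT_gaussBranch hN k hx, h1, ← mul_assoc,
      ← ENNReal.ofReal_mul (by positivity), gaussDensity_gaussBranch hN k hx.1,
      ENNReal.ofReal_mul (gaussDensity_pos hN hx.1).le,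
      ENNReal.ofReal_mul (gaussWeight_nonneg N k hx.1)]
    ring
  simp_rw [hbr]
  rw [← lintegral_tsum, ← Measure.restrict_congr_set (Ico_ae_eq_Ioc (a := (0 : ℝ)) (b := 1))]
  · refine setLIntegral_congr_fun measurableSet_Ico fun x hx => ?_
    rw [ENNReal.tsum_mul_left, ENNReal.tsum_mul_left, gaussTransfer, ENNReal.ofReal_tsum_of_nonneg]
    · exact fun k => mul_nonneg (gaussWeight_nonneg N k hx.1) (hf0 _ (gaussBranch_mem hN k hx.1))
    · exact hs x (Ico_subset_Icc_self hx)
  · intro k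
    have hanti : AntitoneOn (gaussBranch N k) (Ico 0 1) := by
      intro x hx y hy hxy
      have := hx.1
      unfold gaussBranch
      gcongr
    have hmaps : MapsTo (gaussBranch N k) (Ico 0 1) (Ioc 0 1) :=
      fun x hx => gaussBranch_mem hN k hx.1
    have hmeas : AEMeasurable (fun x => f (gaussBranch N k x)) (volume.restrict (Ico 0 1)) := by
      rcases hf with hf | hf
      · exact aemeasurable_restrict_of_antitoneOn measurableSet_Ico (hf.comp_AntitoneOn hanti hmaps)
      · exact aemeasurable_restrict_of_monotoneOn measurableSet_Ico (hf.comp hanti hmaps)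
    have hw : Measurable (gaussWeight N k) := by
      unfold gaussWeight
      fun_prop
    exact (measurable_gaussDensity N).ennreal_ofReal.aemeasurable.mul
      (hG.aemeasurable.mul (hw.aemeasurable.mul hmeas).ennreal_ofReal)

lemma gaussTransfer_one {N : ℕ} (hN : 0 < N) {x : ℝ} (hx : 0 ≤ x) :
    gaussTransfer N (fun _ => 1) x = 1 := by
  simpa [gaussTransfer] using (hasSum_gaussWeight hN hx).tsum_eq

lemma ae_gaussMeasure_mem (N : ℕ) : ∀ᵐ x ∂gaussMeasure N, x ∈ Ioc (0 : ℝ) 1 :=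
  (withDensity_absolutelyContinuous _ _).ae_le (ae_restrict_mem measurableSet_Ioc)

lemma lintegral_comp_gaussT {N : ℕ} (hN : 0 < N) {G : ℝ → ENNReal} (hG : Measurable G) :
    ∫⁻ x, G (gaussT N x) ∂gaussMeasure N = ∫⁻ x, G x ∂gaussMeasure N := by
  have h := lintegral_comp_gaussT_mul hN (f := fun _ => 1) (fun _ _ => zero_le_one)
    (Or.inl monotoneOn_const)
    (fun x hx => by simpa using (hasSum_gaussWeight hN hx.1).summable) hG
  simp only [ENNReal.ofReal_one, mul_one] at h
  rw [h]
  refine lintegral_congr_ae ?_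
  filter_upwards [ae_gaussMeasure_mem N] with x hx
  rw [gaussTransfer_one hN hx.1.le]
  simp

lemma measurePreserving_gaussT {N : ℕ} (hN : 0 < N) :
    MeasurePreserving (gaussT N) (gaussMeasure N) (gaussMeasure N) := by
  refine ⟨measurable_gaussT N, Measure.ext fun s hs => ?_⟩
  have h := lintegral_comp_gaussT hN (measurable_const.indicator hs (f := fun _ => (1 : ENNReal)))
  rw [← lintegral_map (measurable_const.indicator hs) (measurable_gaussT N)] at h
  rwa [lintegral_indicator_const hs, lintegral_indicator_const hs, one_mul, one_mul] at h

lemma integral_gaussDensity {N : ℕ} (hN : 0 < N) : ∫ x in (0 : ℝ)..1, gaussDensity N x = 1 := by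
  have hN' : (0 : ℝ) < N := by exact_mod_cast hN
  have hl := log_one_add_inv_pos hN
  have h : ∀ x ∈ uIcc (0 : ℝ) 1, HasDerivAt
      (fun x => Real.log (N + x) / Real.log (1 + 1 / N)) (gaussDensity N x) x := by
    intro x hx
    rw [uIcc_of_le zero_le_one] at hx
    have h0 : (N : ℝ) + x ≠ 0 := by have := hx.1; positivity
    refine ((((hasDerivAt_id x).const_add (N : ℝ)).log h0).div_const _).congr_deriv ?_
    unfold gaussDensity
    simp only [id]
    rw [div_div, mul_comm]
  rw [intervalIntegral.integral_eq_sub_of_hasDerivAt h]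
  · rw [← sub_div, add_zero, ← Real.log_div (by positivity) (by positivity)]
    rw [add_div, div_self hN'.ne', div_self hl.ne']
  · apply ContinuousOn.intervalIntegrable
    intro x hx
    rw [uIcc_of_le zero_le_one] at hx
    have : Real.log (1 + 1 / N) * (N + x) ≠ 0 := by have := hx.1; positivity
    unfold gaussDensity
    exact ContinuousAt.continuousWithinAt (by fun_prop (disch := assumption))

lemma isProbabilityMeasure_gaussMeasure {N : ℕ} (hN : 0 < N) :
    IsProbabilityMeasure (gaussMeasure N) := by
  refine ⟨?_⟩
  rw [← lintegral_one, lintegral_gaussMeasure]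
  simp only [mul_one]
  have h := integral_gaussDensity hN
  rw [intervalIntegral.integral_of_le zero_le_one] at h
  rw [← ofReal_integral_eq_lintegral_ofReal, h, ENNReal.ofReal_one]
  · by_contra hcon
    rw [integral_undef hcon] at h
    norm_num at h
  · filter_upwards [ae_restrict_mem measurableSet_Ioc] with x hx
    exact (gaussDensity_pos hN hx.1.le).le

/-- Exponential decay of correlations for monotone observables. -/
lemma lintegral_iterate_gaussT_mul_le {N : ℕ} (hN : 0 < N) (k : ℕ) {f : ℝ → ℝ}
    (hf0 : ∀ x ∈ Icc (0 : ℝ) 1, 0 ≤ f x) (hf : UnitMonotone f)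
    {G : ℝ → ENNReal} (hG : Measurable G) :
    ∫⁻ x, G ((gaussT N)^[k] x) * ENNReal.ofReal (f x) ∂gaussMeasure N
      ≤ (∫⁻ x, G x ∂gaussMeasure N) * ((∫⁻ x, ENNReal.ofReal (f x) ∂gaussMeasure N)
          + ENNReal.ofReal (|f 0 - f 1| / 2 ^ k)) := by
  have := isProbabilityMeasure_gaussMeasure hN
  induction k generalizing f with
  | zero =>
    rw [← lintegral_mul_const _ hG]
    refine lintegral_mono_ae ?_
    filter_upwards [ae_gaussMeasure_mem N] with x hx
    simp only [Function.iterate_zero, id, pow_zero, div_one]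
    gcongr
    calc ENNReal.ofReal (f x) = ∫⁻ _, ENNReal.ofReal (f x) ∂gaussMeasure N := by simp
      _ ≤ ∫⁻ y, (ENNReal.ofReal (f y) + ENNReal.ofReal |f 0 - f 1|) ∂gaussMeasure N := by
        refine lintegral_mono_ae ?_
        filter_upwards [ae_gaussMeasure_mem N] with y hy
        rw [← ENNReal.ofReal_add (hf0 y (Ioc_subset_Icc_self hy)) (abs_nonneg _)]
        exact ENNReal.ofReal_le_ofReal
          (hf.le_add (Ioc_subset_Icc_self hx) (Ioc_subset_Icc_self hy))
      _ = _ := by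
        rw [lintegral_add_right _ measurable_const]
        simp
  | succ k ih =>
    have hs := fun x (hx : x ∈ Icc (0 : ℝ) 1) =>
      summable_gaussTransfer hN (fun y hy => hf.abs_le hy) hx
    have hf0' : ∀ x ∈ Ioc (0 : ℝ) 1, 0 ≤ f x := fun x hx => hf0 x (Ioc_subset_Icc_self hx)
    have hf' : MonotoneOn f (Ioc 0 1) ∨ AntitoneOn f (Ioc 0 1) :=
      hf.imp (fun h => h.mono Ioc_subset_Icc_self) fun h => h.mono Ioc_subset_Icc_self
    have hd := lintegral_comp_gaussT_mul hN hf0' hf' hs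
      (hG.comp ((measurable_gaussT N).iterate k))
    have hm := lintegral_comp_gaussT_mul hN hf0' hf' hs (measurable_const (a := (1 : ENNReal)))
    simp only [one_mul] at hm
    simp only [Function.comp_apply, ← Function.iterate_succ_apply] at hd
    rw [hd, hm]
    refine (ih (fun x hx => le_gaussTransfer hN hx hf0 (hs x hx)) (hf.gaussTransfer hN)).trans ?_
    gcongr _ * (_ + ENNReal.ofReal ?_)
    rw [pow_succ', ← div_div]
    gcongr
    exact hf.abs_gaussTransfer_sub_le hN

section SecondMoment

open scoped ENNReal NNReal

variable {α : Type*} [MeasurableSpace α] {μ : Measure α} {T : α → α}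

lemma lintegral_sq_birkhoffSum_le (hT : MeasurePreserving T μ μ) {g : α → ℝ≥0∞}
    (hg : Measurable g) {m C : ℝ≥0∞}
    (hC : ∀ n : ℕ, ∑ k ∈ Finset.range n, ∫⁻ x, g (T^[k + 1] x) * g x ∂μ ≤ n * m ^ 2 + C)
    (n : ℕ) :
    ∫⁻ x, (birkhoffSum T g n x) ^ 2 ∂μ
      ≤ n ^ 2 * m ^ 2 + n * (∫⁻ x, g x ^ 2 ∂μ + 2 * C) := by
  have hS : ∀ n, Measurable (birkhoffSum T g n) := fun n =>
    Finset.measurable_fun_sum _ fun i _ => hg.comp (hT.measurable.iterate i)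
  induction n with
  | zero => simp
  | succ n ih =>
    have hexp : ∀ x, (birkhoffSum T g (n + 1) x) ^ 2
        = g x ^ 2 + (2 * (∑ k ∈ Finset.range n, g (T^[k + 1] x) * g x)
          + (birkhoffSum T g n (T x)) ^ 2) := by
      intro x
      have : ∑ k ∈ Finset.range n, g (T^[k + 1] x) * g x = birkhoffSum T g n (T x) * g x := by
        simp [birkhoffSum, Finset.sum_mul]
      rw [birkhoffSum_succ', this]
      ring
    have hinv : ∫⁻ x, (birkhoffSum T g n (T x)) ^ 2 ∂μ = ∫⁻ x, (birkhoffSum T g n x) ^ 2 ∂μ :=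
      hT.lintegral_comp ((hS n).pow_const 2)
    have hm : ∀ k, Measurable fun x => g (T^[k + 1] x) * g x := fun k =>
      (hg.comp (hT.measurable.iterate (k + 1))).mul hg
    simp_rw [hexp]
    rw [lintegral_add_left (hg.pow_const 2), lintegral_add_left
      ((Finset.measurable_fun_sum _ fun k _ => hm k).const_mul 2), lintegral_const_mul _
      (Finset.measurable_fun_sum _ fun k _ => hm k), lintegral_finsetSum _ fun k _ => hm k, hinv]
    calc _ ≤ ∫⁻ x, g x ^ 2 ∂μ + (2 * (n * m ^ 2 + C)
          + (n ^ 2 * m ^ 2 + n * (∫⁻ x, g x ^ 2 ∂μ + 2 * C))) := by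
          gcongr
          exact hC n
      _ ≤ ∫⁻ x, g x ^ 2 ∂μ + (2 * (n * m ^ 2 + C)
          + (n ^ 2 * m ^ 2 + n * (∫⁻ x, g x ^ 2 ∂μ + 2 * C))) + m ^ 2 := le_self_add
      _ = _ := by push_cast; ring

lemma lintegral_birkhoffSum (hT : MeasurePreserving T μ μ) {g : α → ℝ≥0∞}
    (hg : Measurable g) (n : ℕ) : ∫⁻ x, birkhoffSum T g n x ∂μ = n * ∫⁻ x, g x ∂μ := by
  unfold birkhoffSum
  rw [lintegral_finsetSum (f := fun k x => g (T^[k] x)) _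
    fun k _ => hg.comp (hT.measurable.iterate k)]
  simp [(hT.iterate _).lintegral_comp hg]

lemma lintegral_sq_birkhoffSum_sub_le [IsProbabilityMeasure μ] (hT : MeasurePreserving T μ μ)
    {g : α → ℝ≥0} (hg : Measurable g) {m C : ℝ≥0} (hm : ∫⁻ x, g x ∂μ = m) (n : ℕ)
    (hC : ∫⁻ x, (birkhoffSum T (fun x => (g x : ℝ≥0∞)) n x) ^ 2 ∂μ ≤ n ^ 2 * m ^ 2 + n * C) :
    ∫⁻ x, ENNReal.ofReal ((((birkhoffSum T g n x : ℝ≥0) : ℝ) - n * m) ^ 2) ∂μ ≤ n * C := by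
  have hcoe : ∀ x, birkhoffSum T (fun x => (g x : ℝ≥0∞)) n x = (birkhoffSum T g n x : ℝ≥0) := by
    intro x
    simp [birkhoffSum]
  have hS : Measurable (birkhoffSum T g n) :=
    Finset.measurable_fun_sum _ fun i _ => hg.comp (hT.measurable.iterate i)
  have hmean := lintegral_birkhoffSum hT hg.coe_nnreal_ennreal n
  simp_rw [hcoe] at hmean hC
  rw [hm] at hmean
  have hpt : ∀ x, ENNReal.ofReal ((((birkhoffSum T g n x : ℝ≥0) : ℝ) - n * m) ^ 2)
      + 2 * (n * m) * (birkhoffSum T g n x : ℝ≥0) = ((birkhoffSum T g n x : ℝ≥0) : ℝ≥0∞) ^ 2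
        + (n * m) ^ 2 := by
    intro x
    have e1 : (2 * (n * m) * (birkhoffSum T g n x : ℝ≥0) : ℝ≥0∞)
        = ENNReal.ofReal (2 * (n * m) * (birkhoffSum T g n x : ℝ≥0)) := by
      rw [← ENNReal.ofReal_coe_nnreal]
      rw [ENNReal.ofReal_mul (by positivity), ENNReal.ofReal_mul (by positivity),
        ENNReal.ofReal_mul (by positivity)]
      simp
    have e2 : (((birkhoffSum T g n x : ℝ≥0) : ℝ≥0∞) ^ 2 + (n * m) ^ 2)
        = ENNReal.ofReal (((birkhoffSum T g n x : ℝ≥0) : ℝ) ^ 2 + (n * m) ^ 2) := by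
      rw [ENNReal.ofReal_add (by positivity) (by positivity), ENNReal.ofReal_pow (by positivity),
        ENNReal.ofReal_pow (by positivity), ENNReal.ofReal_mul (by positivity)]
      simp
    rw [e1, e2, ← ENNReal.ofReal_add (by positivity) (by positivity)]
    congr 1
    ring
  have hint := lintegral_congr (μ := μ) hpt
  rw [lintegral_add_right _ (hS.coe_nnreal_ennreal.const_mul _),
    lintegral_const_mul _ hS.coe_nnreal_ennreal, hmean, lintegral_add_right _ measurable_const,
    lintegral_const, measure_univ, mul_one] at hint
  have hfin : (2 * (n * m) * (n * m) : ℝ≥0∞) ≠ ∞ := by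
    have : (2 * (n * m) * (n * m) : ℝ≥0∞) = ((2 * (n * m) * (n * m) : ℝ≥0) : ℝ≥0∞) := by simp
    rw [this]
    exact ENNReal.coe_ne_top
  refine (ENNReal.add_le_add_iff_right hfin).1 ?_
  rw [hint]
  calc _ ≤ (n ^ 2 * m ^ 2 + n * C + (n * m) ^ 2 : ℝ≥0∞) := by gcongr
    _ = _ := by ring

/-- A strong law of large numbers for nonnegative observables whose Birkhoff sums have linearly
growing variance. -/
lemma ae_tendsto_birkhoffSum_div [IsProbabilityMeasure μ] (hT : MeasurePreserving T μ μ)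
    {g : α → ℝ≥0} (hg : Measurable g) {m C : ℝ≥0} (hm : ∫⁻ x, g x ∂μ = m)
    (hC : ∀ n : ℕ,
      ∫⁻ x, (birkhoffSum T (fun x => (g x : ℝ≥0∞)) n x) ^ 2 ∂μ ≤ n ^ 2 * m ^ 2 + n * C) :
    ∀ᵐ x ∂μ, Tendsto (fun n : ℕ => ((birkhoffSum T g n x : ℝ≥0) : ℝ) / n) atTop (nhds m) := by
  have hS : ∀ n, Measurable (birkhoffSum T g n) := fun n =>
    Finset.measurable_fun_sum _ fun i _ => hg.comp (hT.measurable.iterate i)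
  set u : ℕ → α → ℝ≥0∞ := fun j x =>
    ENNReal.ofReal ((((birkhoffSum T g ((j + 1) ^ 2) x : ℝ≥0) : ℝ) / ((j + 1) ^ 2 : ℕ) - m) ^ 2) with hu
  have hum : ∀ j, Measurable (u j) := fun j =>
    ((((hS _).coe_nnreal_real.div_const _).sub_const _).pow_const 2).ennreal_ofReal
  have hbound : ∀ j, ∫⁻ x, u j x ∂μ ≤ ENNReal.ofReal (C * (1 / ((j + 1 : ℕ) : ℝ) ^ 2)) := by
    intro j
    have h := lintegral_sq_birkhoffSum_sub_le hT hg hm ((j + 1) ^ 2) (hC _)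
    set n : ℕ := (j + 1) ^ 2 with hn
    have hn0 : (0 : ℝ) < n := by rw [hn]; positivity
    have e : ∀ x, u j x = ENNReal.ofReal ((1 / n) ^ 2)
        * ENNReal.ofReal ((((birkhoffSum T g n x : ℝ≥0) : ℝ) - n * m) ^ 2) := by
      intro x
      rw [← ENNReal.ofReal_mul (by positivity)]
      simp only [hu, ← hn]
      congr 1
      field_simp
    simp_rw [e]
    rw [lintegral_const_mul _
      (((hS _).coe_nnreal_real.sub_const _).pow_const 2).ennreal_ofReal]
    calc _ ≤ ENNReal.ofReal ((1 / n) ^ 2) * (n * C) := by gcongr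
      _ = ENNReal.ofReal ((1 / n) ^ 2) * ENNReal.ofReal (n * C) := by
        rw [ENNReal.ofReal_mul (by positivity)]; simp
      _ = ENNReal.ofReal ((1 / n) ^ 2 * (n * C)) :=
        (ENNReal.ofReal_mul (by positivity)).symm
      _ = _ := by
        congr 1
        have : ((j + 1 : ℕ) : ℝ) ^ 2 = n := by rw [hn]; push_cast; ring
        rw [this]
        field_simp
  have hsum : Summable fun j : ℕ => (C : ℝ) * (1 / ((j + 1 : ℕ) : ℝ) ^ 2) :=
    ((summable_nat_add_iff 1).2 (Real.summable_one_div_nat_pow.2 one_lt_two)).mul_left _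
  have hfin : ∫⁻ x, ∑' j, u j x ∂μ ≠ ∞ := by
    rw [lintegral_tsum fun j => (hum j).aemeasurable]
    refine ne_top_of_le_ne_top ?_ (ENNReal.tsum_le_tsum hbound)
    rw [← ENNReal.ofReal_tsum_of_nonneg (fun j => by positivity) hsum]
    exact ENNReal.ofReal_ne_top
  filter_upwards [ae_lt_top (Measurable.tsum hum) hfin] with x hx
  have h0 := ENNReal.tendsto_atTop_zero_of_tsum_ne_top hx.ne
  have h1 : Tendsto (fun j : ℕ => ((birkhoffSum T g ((j + 1) ^ 2) x : ℝ≥0) : ℝ) / ((j + 1) ^ 2 : ℕ))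
      atTop (nhds m) := by
    have h2 := (ENNReal.tendsto_toReal ENNReal.zero_ne_top).comp h0
    have h3 : Tendsto (fun j : ℕ =>
        (((birkhoffSum T g ((j + 1) ^ 2) x : ℝ≥0) : ℝ) / ((j + 1) ^ 2 : ℕ) - m) ^ 2) atTop (nhds 0) := by
      refine h2.congr fun j => ?_
      simp only [Function.comp_apply, hu]
      rw [ENNReal.toReal_ofReal (sq_nonneg _)]
    have h4 := h3.sqrt
    simp only [Real.sqrt_sq_eq_abs, Real.sqrt_zero] at h4
    have h5 := (tendsto_zero_iff_abs_tendsto_zero _).2 h4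
    simpa using h5.add_const (m : ℝ)
  refine tendsto_div_of_monotone_of_exists_subseq_tendsto_div _ _ ?_ fun a ha =>
    ⟨fun j => (j + 1) ^ 2, ?_, ?_, h1⟩
  · refine monotone_nat_of_le_succ fun n => ?_
    rw [birkhoffSum_succ]
    exact_mod_cast le_self_add
  · have hlim : Tendsto (fun j : ℕ => (1 + 1 / ((j : ℝ) + 1)) ^ 2) atTop (nhds 1) := by
      simpa using (tendsto_one_div_add_atTop_nhds_zero_nat (𝕜 := ℝ)).const_add 1 |>.pow 2
    filter_upwards [hlim.eventually_lt_const ha] with j hj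
    push_cast
    have : ((j : ℝ) + 1 + 1) ^ 2 = (1 + 1 / ((j : ℝ) + 1)) ^ 2 * (j + 1) ^ 2 := by
      field_simp
    rw [this]
    gcongr
  · exact (tendsto_pow_atTop two_ne_zero).comp (tendsto_add_atTop_nat 1)

end SecondMoment

lemma antitoneOn_neg_log : AntitoneOn (fun x => -Real.log x) (Ioc 0 1) :=
  fun _ hx _ _ hxy => neg_le_neg (Real.log_le_log hx.1 hxy)

lemma neg_log_nonneg {x : ℝ} (hx : x ∈ Ioc (0 : ℝ) 1) : 0 ≤ -Real.log x :=
  neg_nonneg.2 (Real.log_nonpos hx.1.le hx.2)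

lemma summable_gaussWeight_mul_neg_log {N : ℕ} (hN : 0 < N) {x : ℝ} (hx : x ∈ Icc (0 : ℝ) 1) :
    Summable fun k => gaussWeight N k x * -Real.log (gaussBranch N k x) := by
  have hN' : (1 : ℝ) ≤ N := by exact_mod_cast hN
  have hbase : Summable fun k : ℕ => 4 * (N + 1) * (1 / ((k + 1 : ℕ) : ℝ) ^ (3 / 2 : ℝ)) :=
    ((summable_nat_add_iff 1).2 (Real.summable_one_div_nat_rpow.2 (by norm_num))).mul_left _
  refine Summable.of_nonneg_of_le (fun k => mul_nonneg (gaussWeight_nonneg N k hx.1)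
    (neg_log_nonneg (gaussBranch_mem hN k hx.1))) (fun k => ?_) hbase
  obtain ⟨hx0, hx1⟩ := hx
  have hk : (0 : ℝ) ≤ k := by positivity
  have h1 : gaussWeight N k x ≤ (N + 1) / ((k + 1) * (k + 1)) := by
    unfold gaussWeight
    exact div_le_div₀ (by positivity) (by linarith) (by positivity)
      (mul_le_mul (by linarith) (by linarith) (by positivity) (by linarith))
  have h2 : -Real.log (gaussBranch N k x) ≤ 4 * ((k : ℝ) + 1) ^ (1 / 2 : ℝ) := by
    rw [← Real.log_inv, gaussBranch, inv_div]
    have h3 : (N + k + x) / N ≤ 4 * ((k : ℝ) + 1) := by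
      rw [div_le_iff₀ (by linarith)]
      nlinarith
    calc Real.log ((N + k + x) / N) ≤ ((N + k + x) / N) ^ (1 / 2 : ℝ) / (1 / 2) :=
          Real.log_le_rpow_div (by positivity) (by norm_num)
      _ ≤ (4 * ((k : ℝ) + 1)) ^ (1 / 2 : ℝ) / (1 / 2) := by gcongr
      _ = _ := by
        rw [Real.mul_rpow (by norm_num) (by positivity),
          show (4 : ℝ) = 2 ^ (2 : ℝ) by norm_num, ← Real.rpow_mul (by norm_num)]
        norm_num
        ring
  calc _ ≤ (N + 1) / ((k + 1) * (k + 1)) * (4 * ((k : ℝ) + 1) ^ (1 / 2 : ℝ)) := by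
        gcongr
        exact neg_log_nonneg (gaussBranch_mem hN k hx0)
    _ = _ := by
      have h4 : ((k : ℝ) + 1) ^ (3 / 2 : ℝ) = (k + 1) * ((k : ℝ) + 1) ^ (1 / 2 : ℝ) := by
        rw [show (3 / 2 : ℝ) = 1 + 1 / 2 by norm_num, Real.rpow_add (by positivity), Real.rpow_one]
      have h5 : ((k : ℝ) + 1) ^ (1 / 2 : ℝ) * ((k : ℝ) + 1) ^ (1 / 2 : ℝ) = k + 1 := by
        rw [← Real.rpow_add (by positivity)]
        norm_num
      have h6 : ((k : ℝ) + 1) ^ (1 / 2 : ℝ) ≠ 0 := by positivity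
      push_cast
      rw [h4]
      generalize ((k : ℝ) + 1) ^ (1 / 2 : ℝ) = r at *
      field_simp
      rw [← h5]
      ring

lemma exists_correlation_bound {N : ℕ} (hN : 0 < N) : ∃ D : ℝ, 0 ≤ D ∧ ∀ k,
    ∫⁻ x, ENNReal.ofReal (-Real.log ((gaussT N)^[k + 1] x)) * ENNReal.ofReal (-Real.log x)
        ∂gaussMeasure N
      ≤ (∫⁻ x, ENNReal.ofReal (-Real.log x) ∂gaussMeasure N) *
        ((∫⁻ x, ENNReal.ofReal (-Real.log x) ∂gaussMeasure N) + ENNReal.ofReal (D / 2 ^ k)) := by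
  set f := gaussTransfer N fun x => -Real.log x with hf
  have hs := fun x (hx : x ∈ Icc (0 : ℝ) 1) => summable_gaussWeight_mul_neg_log hN hx
  have hmeas : Measurable fun x => ENNReal.ofReal (-Real.log x) := by fun_prop
  have hm := lintegral_comp_gaussT_mul hN (fun x => neg_log_nonneg) (Or.inr antitoneOn_neg_log) hs
    (measurable_const (a := (1 : ENNReal)))
  simp only [one_mul] at hm
  refine ⟨|f 0 - f 1|, abs_nonneg _, fun k => ?_⟩
  have hd := lintegral_comp_gaussT_mul hN (fun x => neg_log_nonneg) (Or.inr antitoneOn_neg_log) hs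
    (hmeas.comp ((measurable_gaussT N).iterate k))
  simp only [Function.comp_apply, ← Function.iterate_succ_apply] at hd
  rw [hd]
  refine (lintegral_iterate_gaussT_mul_le hN k (f := f) (fun x hx => tsum_nonneg fun j =>
    mul_nonneg (gaussWeight_nonneg N j hx.1) (neg_log_nonneg (gaussBranch_mem hN j hx.1)))
    (Or.inl (gaussTransfer_monotoneOn hN antitoneOn_neg_log hs)) hmeas).trans_eq ?_
  rw [← hm]

lemma lintegral_sq_neg_log_ne_top {N : ℕ} (hN : 0 < N) :
    ∫⁻ x, ENNReal.ofReal (-Real.log x) ^ 2 ∂gaussMeasure N ≠ ⊤ := by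
  have hN' : (0 : ℝ) < N := by exact_mod_cast hN
  have hl := log_one_add_inv_pos hN
  set c : ℝ := 1 / (Real.log (1 + 1 / N) * N) * 16 with hc
  have hint : IntegrableOn (fun x : ℝ => c * x ^ (-(1 / 2) : ℝ)) (Ioc 0 1) := by
    have := intervalIntegral.intervalIntegrable_rpow' (a := 0) (b := 1)
      (by norm_num : (-1 : ℝ) < -(1 / 2))
    exact ((intervalIntegrable_iff_integrableOn_Ioc_of_le zero_le_one).1 this).const_mul c
  rw [lintegral_gaussMeasure]
  refine ne_top_of_le_ne_top (hint.lintegral_lt_top).ne (setLIntegral_mono' measurableSet_Ioc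
    fun x hx => ?_)
  rw [← ENNReal.ofReal_pow (neg_log_nonneg hx), ← ENNReal.ofReal_mul (gaussDensity_pos hN hx.1.le).le]
  apply ENNReal.ofReal_le_ofReal
  rw [hc, mul_assoc]
  have hx0 := hx.1
  have h1 : |Real.log x * x ^ (1 / 4 : ℝ)| < 1 / (1 / 4) :=
    Real.abs_log_mul_self_rpow_lt x _ hx.1 hx.2 (by norm_num)
  have h2 : (Real.log x * x ^ (1 / 4 : ℝ)) ^ 2 ≤ 16 := by
    rw [← sq_abs]
    have := abs_nonneg (Real.log x * x ^ (1 / 4 : ℝ))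
    nlinarith
  have h3 : (x ^ (1 / 4 : ℝ)) ^ 2 = x ^ (1 / 2 : ℝ) := by
    rw [← Real.rpow_natCast, ← Real.rpow_mul hx0.le]
    norm_num
  unfold gaussDensity
  gcongr
  · linarith
  · rw [Real.rpow_neg hx0.le, neg_sq, ← div_eq_mul_inv, le_div_iff₀ (by positivity), ← h3, ← mul_pow]
    exact h2

/-- The integral of `-log` against the Gauss density, evaluated through integration by parts. -/
lemma integral_neg_log_div {N : ℕ} (hN : 0 < N) :
    IntervalIntegrable (fun x => -Real.log x / (N + x)) volume 0 1 ∧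
      ∫ x in (0 : ℝ)..1, -Real.log x / (N + x) = dilogTheta (1 / N) := by
  have hN' : (0 : ℝ) < N := by exact_mod_cast hN
  have hbound : ∀ x : ℝ, 0 ≤ x → Real.log (1 + x / N) ≤ x / N := fun x hx => by
    have := Real.log_le_sub_one_of_pos (by positivity : 0 < 1 + x / N)
    linarith
  have hnn : ∀ x : ℝ, 0 ≤ x → 0 ≤ Real.log (1 + x / N) := fun x hx => by
    apply Real.log_nonneg
    have : 0 ≤ x / N := by positivity
    linarith
  have hi1 : IntervalIntegrable (fun x => -Real.log x / (N + x)) volume 0 1 := by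
    have h := (intervalIntegral.intervalIntegrable_log' (a := 0) (b := 1)).neg
    have h2 := h.mul_continuousOn (g := fun x => ((N : ℝ) + x)⁻¹) (by
      intro x hx
      rw [uIcc_of_le zero_le_one] at hx
      have : (N : ℝ) + x ≠ 0 := by have := hx.1; positivity
      exact ContinuousAt.continuousWithinAt (by fun_prop (disch := assumption)))
    simpa [div_eq_mul_inv] using h2
  have hi2 : IntervalIntegrable (fun x => Real.log (1 + x / N) / x) volume 0 1 := by
    rw [intervalIntegrable_iff_integrableOn_Ioc_of_le zero_le_one]
    refine Measure.integrableOn_of_bounded (M := 1 / N) (by simp)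
      (Measurable.aestronglyMeasurable (by fun_prop)) ?_
    filter_upwards [ae_restrict_mem measurableSet_Ioc] with x hx
    rw [Real.norm_of_nonneg (div_nonneg (hnn x hx.1.le) hx.1.le), div_le_iff₀ hx.1]
    have := hbound x hx.1.le
    rwa [one_div_mul_eq_div]
  refine ⟨hi1, ?_⟩
  have hcv : dilogTheta (1 / N) = ∫ x in (0 : ℝ)..1, Real.log (1 + x / N) / x := by
    have h := intervalIntegral.inv_smul_integral_comp_div (a := 0) (b := 1)
      (fun t => Real.log (1 + t) / t) (N : ℝ)
    rw [zero_div] at h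
    rw [dilogTheta, ← h, ← intervalIntegral.integral_smul]
    refine intervalIntegral.integral_congr fun x _ => ?_
    simp only [smul_eq_mul]
    field_simp
  have hFTC := intervalIntegral.integral_eq_sub_of_hasDerivAt_of_le zero_le_one
    (f := fun x => Real.log (1 + x / N) * Real.log x)
    (f' := fun x => Real.log (1 + x / N) / x - -Real.log x / (N + x)) ?_ ?_ (hi2.sub hi1)
  · rw [intervalIntegral.integral_sub hi2 hi1] at hFTC
    simp only [Real.log_one, Real.log_zero, mul_zero, sub_zero] at hFTC
    rw [hcv]
    linarith
  · intro x hx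
    rcases hx.1.eq_or_lt with rfl | hx0
    · have hlim : Tendsto (fun x : ℝ => x * |Real.log x| / N) (nhds 0) (nhds 0) := by
        have h : Continuous fun x : ℝ => |x * Real.log x| / N := by
          exact (Real.continuous_mul_log.abs).div_const _
        have h2 := (h.tendsto 0)
        simp only [zero_mul, abs_zero, zero_div] at h2
        refine squeeze_zero_norm (fun x => ?_) h2
        rw [norm_div, norm_mul, abs_mul]
        simp
      rw [ContinuousWithinAt]
      simp only [Real.log_zero, mul_zero]
      refine squeeze_zero_norm' ?_ (hlim.mono_left nhdsWithin_le_nhds)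
      filter_upwards [self_mem_nhdsWithin] with x hx
      rw [norm_mul, Real.norm_of_nonneg (hnn x hx.1), Real.norm_eq_abs, mul_div_right_comm]
      gcongr
      exact hbound x hx.1
    · have h1 : 1 + x / N ≠ 0 := by positivity
      have h2 := hx0.ne'
      exact ContinuousAt.continuousWithinAt (by fun_prop (disch := assumption))
  · intro x hx
    have hx0 := hx.1
    have h1 : 1 + x / N ≠ 0 := by positivity
    refine (((((hasDerivAt_id x).div_const (N : ℝ)).const_add 1).log h1).mul
      (Real.hasDerivAt_log hx0.ne')).congr_deriv ?_
    have h3 : (N : ℝ) + x ≠ 0 := by positivity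
    simp only [id]
    field_simp
    ring

lemma lintegral_neg_log {N : ℕ} (hN : 0 < N) :
    0 ≤ gaussLambda N ∧
    ∫⁻ x, ENNReal.ofReal (-Real.log x) ∂gaussMeasure N = ENNReal.ofReal (gaussLambda N) := by
  have hl := log_one_add_inv_pos hN
  obtain ⟨hi, h⟩ := integral_neg_log_div hN
  have hnn : ∀ x ∈ Ioc (0 : ℝ) 1,
      0 ≤ 1 / Real.log (1 + 1 / N) * (-Real.log x / (N + x)) := fun x hx => by
    have := neg_log_nonneg hx
    have := hx.1
    positivity
  have heq : gaussLambda N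
      = ∫ x in Ioc (0 : ℝ) 1, 1 / Real.log (1 + 1 / N) * (-Real.log x / (N + x)) := by
    rw [integral_const_mul, ← intervalIntegral.integral_of_le zero_le_one, h, gaussLambda]
    ring
  refine ⟨heq ▸ setIntegral_nonneg measurableSet_Ioc hnn, ?_⟩
  rw [lintegral_gaussMeasure, heq, ofReal_integral_eq_lintegral_ofReal]
  · refine setLIntegral_congr_fun measurableSet_Ioc fun x hx => ?_
    rw [← ENNReal.ofReal_mul (gaussDensity_pos hN hx.1.le).le, gaussDensity]
    congr 1
    field_simp
  · exact ((intervalIntegrable_iff_integrableOn_Ioc_of_le zero_le_one).1 hi).const_mul _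
  · filter_upwards [ae_restrict_mem measurableSet_Ioc] with x hx using hnn x hx

lemma ae_tendsto_birkhoffSum_neg_log {N : ℕ} (hN : 0 < N) :
    ∀ᵐ x ∂gaussMeasure N, Tendsto
      (fun n : ℕ => ((birkhoffSum (gaussT N) (fun y => (-Real.log y).toNNReal) n x : NNReal) : ℝ)
        / n) atTop (nhds (gaussLambda N)) := by
  have := isProbabilityMeasure_gaussMeasure hN
  obtain ⟨hpos, hmean⟩ := lintegral_neg_log hN
  obtain ⟨D, hD, hcor⟩ := exists_correlation_bound hN
  have hT := measurePreserving_gaussT hN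
  set m : NNReal := (gaussLambda N).toNNReal with hm
  have hmR : (m : ℝ) = gaussLambda N := Real.coe_toNNReal _ hpos
  have hmean' : ∫⁻ x, ((-Real.log x).toNNReal : ENNReal) ∂gaussMeasure N = m := hmean
  have hg : Measurable fun y : ℝ => (-Real.log y).toNNReal := by fun_prop
  have hsum : ∀ n : ℕ, ∑ k ∈ Finset.range n, ENNReal.ofReal (D / 2 ^ k)
      ≤ ENNReal.ofReal (2 * D) := by
    intro n
    rw [← ENNReal.ofReal_sum_of_nonneg fun k _ => by positivity]
    apply ENNReal.ofReal_le_ofReal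
    have := sum_geometric_two_le n
    simp_rw [div_eq_mul_inv, ← Finset.mul_sum, ← inv_pow]
    simp only [one_div] at this
    rw [mul_comm 2]
    gcongr
  have hC := lintegral_sq_birkhoffSum_le hT hg.coe_nnreal_ennreal (m := m)
    (C := m * ENNReal.ofReal (2 * D)) fun n => by
      calc _ ≤ ∑ k ∈ Finset.range n, (m : ENNReal) * (m + ENNReal.ofReal (D / 2 ^ k)) := by
            refine Finset.sum_le_sum fun k _ => ?_
            have := hcor k
            rwa [hmean] at this
        _ = n * (m : ENNReal) ^ 2 + m * ∑ k ∈ Finset.range n, ENNReal.ofReal (D / 2 ^ k) := by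
            rw [← Finset.mul_sum, Finset.sum_add_distrib]
            simp only [Finset.sum_const, Finset.card_range, nsmul_eq_mul]
            ring
        _ ≤ _ := by
            gcongr
            exact hsum n
  have hfin : (∫⁻ x, ((-Real.log x).toNNReal : ENNReal) ^ 2 ∂gaussMeasure N)
      + 2 * (m * ENNReal.ofReal (2 * D)) ≠ ⊤ :=
    ENNReal.add_ne_top.2 ⟨lintegral_sq_neg_log_ne_top hN, ENNReal.mul_ne_top (by simp)
      (ENNReal.mul_ne_top ENNReal.coe_ne_top ENNReal.ofReal_ne_top)⟩
  rw [← hmR]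
  refine ae_tendsto_birkhoffSum_div hT hg hmean' (C := ENNReal.toNNReal
    ((∫⁻ x, ((-Real.log x).toNNReal : ENNReal) ^ 2 ∂gaussMeasure N)
      + 2 * (m * ENNReal.ofReal (2 * D)))) fun n => ?_
  rw [ENNReal.coe_toNNReal hfin]
  exact hC n

lemma ae_forall_iterate_mem {N : ℕ} (hN : 0 < N) :
    ∀ᵐ x ∂gaussMeasure N, ∀ n, (gaussT N)^[n] x ∈ Ioo (0 : ℝ) 1 := by
  rw [ae_all_iff]
  intro n
  refine ((measurePreserving_gaussT hN).iterate n).quasiMeasurePreserving.ae ?_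
  refine (withDensity_absolutelyContinuous _ _).ae_le ?_
  rw [← Measure.restrict_congr_set (Ioo_ae_eq_Ioc (a := (0 : ℝ)) (b := 1))]
  exact ae_restrict_mem measurableSet_Ioo

section Convergents

variable {N : ℕ} {x : ℝ}

lemma floor_mul_iterate (hx : ∀ n, (gaussT N)^[n] x ∈ Ioo (0 : ℝ) 1) (n : ℕ) :
    (⌊(N : ℝ) / (gaussT N)^[n] x⌋ : ℝ) * (gaussT N)^[n] x
      = N - (gaussT N)^[n] x * (gaussT N)^[n + 1] x := by
  have h0 := (hx n).1.ne'
  rw [Function.iterate_succ_apply', gaussT, if_neg h0, Int.fract]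
  field_simp
  ring

lemma le_floor_div_iterate (hx : ∀ n, (gaussT N)^[n] x ∈ Ioo (0 : ℝ) 1) (n : ℕ) :
    (N : ℤ) ≤ ⌊(N : ℝ) / (gaussT N)^[n] x⌋ := by
  refine Int.le_floor.2 ?_
  rw [le_div_iff₀ (hx n).1]
  have : (0 : ℝ) ≤ N := by positivity
  push_cast
  nlinarith [(hx n).2]

lemma gaussB_bounds (hN : 0 < N) (hx : ∀ n, (gaussT N)^[n] x ∈ Ioo (0 : ℝ) 1) (n : ℕ) :
    0 ≤ gaussB N x n ∧ gaussB N x n ≤ gaussB N x (n + 1) ∧ 1 ≤ gaussB N x (n + 1) := by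
  have hN' : (1 : ℤ) ≤ N := by exact_mod_cast hN
  induction n with
  | zero => simp [gaussB]
  | succ n ih =>
    obtain ⟨h0, h1, h2⟩ := ih
    have ha := le_floor_div_iterate hx n
    have h3 : gaussB N x (n + 1) ≤ gaussB N x (n + 2) := by
      rw [gaussB]
      nlinarith [mul_nonneg (by linarith : (0 : ℤ) ≤ N) h0]
    exact ⟨by linarith, h3, by linarith⟩

lemma gaussB_mul_sub_gaussA (hx : ∀ n, (gaussT N)^[n] x ∈ Ioo (0 : ℝ) 1) (n : ℕ) :
    (gaussB N x n * x - gaussA N x n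
        = (-1) ^ (n + 1) * ∏ k ∈ Finset.range n, (gaussT N)^[k] x) ∧
      gaussB N x (n + 1) * x - gaussA N x (n + 1)
        = (-1) ^ n * ∏ k ∈ Finset.range (n + 1), (gaussT N)^[k] x := by
  induction n with
  | zero => simp [gaussA, gaussB]
  | succ n ih =>
    obtain ⟨h0, h1⟩ := ih
    refine ⟨by rw [h1]; ring, ?_⟩
    rw [gaussA, gaussB]
    push_cast
    have ha := floor_mul_iterate hx n
    rw [Finset.prod_range_succ] at h1
    rw [Finset.prod_range_succ, Finset.prod_range_succ]
    linear_combination (⌊(N : ℝ) / (gaussT N)^[n] x⌋ : ℝ) * h1 + (N : ℝ) * h0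
      + (-1) ^ n * (∏ k ∈ Finset.range n, (gaussT N)^[k] x) * ha

lemma gaussB_add_mul_prod (hx : ∀ n, (gaussT N)^[n] x ∈ Ioo (0 : ℝ) 1) (n : ℕ) :
    (gaussB N x (n + 1) + (gaussT N)^[n] x * gaussB N x n)
      * ∏ k ∈ Finset.range n, (gaussT N)^[k] x = (N : ℝ) ^ n := by
  induction n with
  | zero => simp [gaussB]
  | succ n ih =>
    rw [gaussB, Finset.prod_range_succ, pow_succ, ← ih]
    push_cast
    have ha := floor_mul_iterate hx n
    linear_combination gaussB N x (n + 1) * (∏ k ∈ Finset.range n, (gaussT N)^[k] x) * ha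

/-- The approximation error of the `n`-th convergent, up to a bounded factor. -/
lemma abs_neg_log_sub_convergent_sub_le (hN : 0 < N)
    (hx : ∀ n, (gaussT N)^[n] x ∈ Ioo (0 : ℝ) 1) (n : ℕ) :
    |-Real.log |x - (gaussA N x (n + 1) : ℝ) / (gaussB N x (n + 1) : ℝ)|
      - (n * Real.log N + ∑ k ∈ Finset.range n, -Real.log ((gaussT N)^[k] x)
        + ∑ k ∈ Finset.range (n + 1), -Real.log ((gaussT N)^[k] x))| ≤ Real.log 2 := by
  obtain ⟨hb0, hb1, hb2⟩ := gaussB_bounds hN hx n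
  have hN' : (0 : ℝ) < N := by exact_mod_cast hN
  have hB0 : (0 : ℝ) ≤ gaussB N x n := by exact_mod_cast hb0
  have hB1 : (gaussB N x n : ℝ) ≤ gaussB N x (n + 1) := by exact_mod_cast hb1
  have hB2 : (1 : ℝ) ≤ gaussB N x (n + 1) := by exact_mod_cast hb2
  have hB3 : (0 : ℝ) < gaussB N x (n + 1) := by linarith
  have hprod : ∀ n, 0 < ∏ k ∈ Finset.range n, (gaussT N)^[k] x := fun n =>
    Finset.prod_pos fun k _ => (hx k).1
  have hlogprod : ∀ n, Real.log (∏ k ∈ Finset.range n, (gaussT N)^[k] x)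
      = -∑ k ∈ Finset.range n, -Real.log ((gaussT N)^[k] x) := fun n => by
    rw [Real.log_prod fun k _ => (hx k).1.ne', Finset.sum_neg_distrib, neg_neg]
  have herr : |x - (gaussA N x (n + 1) : ℝ) / (gaussB N x (n + 1) : ℝ)|
      = (∏ k ∈ Finset.range (n + 1), (gaussT N)^[k] x) / gaussB N x (n + 1) := by
    have h := (gaussB_mul_sub_gaussA hx n).2
    have h2 : x - (gaussA N x (n + 1) : ℝ) / (gaussB N x (n + 1) : ℝ)
        = (gaussB N x (n + 1) * x - gaussA N x (n + 1)) / gaussB N x (n + 1) := by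
      field_simp
    rw [h2, h, abs_div, abs_mul, abs_pow, abs_neg, abs_one, one_pow, one_mul,
      abs_of_pos (hprod _), abs_of_pos hB3]
  set E : ℝ := gaussB N x (n + 1) + (gaussT N)^[n] x * gaussB N x n with hE
  have hE1 : (gaussB N x (n + 1) : ℝ) ≤ E := by
    have := mul_nonneg (hx n).1.le hB0
    linarith
  have hE2 : E ≤ 2 * gaussB N x (n + 1) := by nlinarith [(hx n).1, (hx n).2]
  have hE3 : 0 < E := by linarith
  have hlogE : Real.log E
      = n * Real.log N + ∑ k ∈ Finset.range n, -Real.log ((gaussT N)^[k] x) := by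
    have h := congrArg Real.log (gaussB_add_mul_prod hx n)
    rw [Real.log_mul hE3.ne' (hprod n).ne', hlogprod, Real.log_pow] at h
    linarith
  rw [herr, Real.log_div (hprod _).ne' hB3.ne', hlogprod, ← hlogE]
  have h1 := Real.log_le_log hB3 hE1
  have h2 := Real.log_le_log hE3 hE2
  rw [Real.log_mul two_ne_zero hB3.ne'] at h2
  rw [abs_le]
  constructor <;> linarith

end Convergents

/-- For Lebesgue almost every `x ∈ [0,1)`, the convergents `A_n/B_n` of the
`N`-continued fraction of `x` satisfy
`-(1/n) log |x - A_n/B_n| → 2Λ_N + log N`. -/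
theorem gaussT_convergence_rate (N : ℕ) (hN : 0 < N) :
    ∀ᵐ x ∂(volume.restrict (Set.Ico (0:ℝ) 1)),
      Tendsto (fun n : ℕ =>
          -(1 / (n : ℝ)) *
            Real.log |x - (gaussA N x (n + 1) : ℝ) / (gaussB N x (n + 1) : ℝ)|)
        atTop (nhds (2 * gaussLambda N + Real.log N)) := by
  have hae : ∀ᵐ x ∂gaussMeasure N, Tendsto (fun n : ℕ =>
          -(1 / (n : ℝ)) *
            Real.log |x - (gaussA N x (n + 1) : ℝ) / (gaussB N x (n + 1) : ℝ)|)
        atTop (nhds (2 * gaussLambda N + Real.log N)) := by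
    filter_upwards [ae_tendsto_birkhoffSum_neg_log hN, ae_forall_iterate_mem hN] with x hlim hx
    set S : ℕ → ℝ := fun n => ∑ k ∈ Finset.range n, -Real.log ((gaussT N)^[k] x) with hS
    have hSlim : Tendsto (fun n : ℕ => S n / n) atTop (nhds (gaussLambda N)) := by
      refine hlim.congr fun n => ?_
      simp only [birkhoffSum, hS, NNReal.coe_sum]
      congr 1
      exact Finset.sum_congr rfl fun k _ =>
        Real.coe_toNNReal _ (neg_log_nonneg (Ioo_subset_Ioc_self (hx k)))
    have hinv : Tendsto (fun n : ℕ => 1 / (n : ℝ)) atTop (nhds 0) :=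
      tendsto_one_div_atTop_nhds_zero_nat
    have hSlim' : Tendsto (fun n : ℕ => S (n + 1) / n) atTop (nhds (gaussLambda N)) := by
      have h1 := (hSlim.comp (tendsto_add_atTop_nat 1)).mul (hinv.const_add 1)
      simp only [add_zero, mul_one] at h1
      refine h1.congr' ?_
      filter_upwards [eventually_gt_atTop 0] with n hn
      have hn' : (0 : ℝ) < n := by exact_mod_cast hn
      simp only [Function.comp_apply]
      push_cast
      field_simp
    have hmain : Tendsto (fun n : ℕ => Real.log N + S n / n + S (n + 1) / n) atTop
        (nhds (2 * gaussLambda N + Real.log N)) := by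
      have h := (hSlim.const_add (Real.log N)).add hSlim'
      convert h using 2
      ring
    have hz : Tendsto (fun n : ℕ => Real.log 2 * (1 / (n : ℝ))) atTop (nhds 0) := by
      simpa using hinv.const_mul (Real.log 2)
    refine tendsto_of_tendsto_of_dist hmain ?_
    refine squeeze_zero' (Eventually.of_forall fun _ => dist_nonneg) ?_ hz
    filter_upwards [eventually_gt_atTop 0] with n hn
    have hn' : (0 : ℝ) < n := by exact_mod_cast hn
    have h := abs_neg_log_sub_convergent_sub_le hN hx n
    rw [dist_comm, Real.dist_eq]
    calc _ = |1 / (n : ℝ) * (-Real.log |x - (gaussA N x (n + 1) : ℝ) / (gaussB N x (n + 1) : ℝ)|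
          - (n * Real.log N + S n + S (n + 1)))| := by
          congr 1
          field_simp
      _ ≤ 1 / n * Real.log 2 := by
          rw [abs_mul, abs_of_pos (by positivity : 0 < 1 / (n : ℝ))]
          gcongr
      _ = Real.log 2 * (1 / n) := mul_comm _ _
  rw [gaussMeasure, ae_withDensity_iff (measurable_gaussDensity N).ennreal_ofReal] at hae
  rw [Measure.restrict_congr_set (Ico_ae_eq_Ioc (a := (0 : ℝ)) (b := 1))]
  filter_upwards [hae, ae_restrict_mem measurableSet_Ioc] with x h hx
  exact h (ENNReal.ofReal_pos.2 (gaussDensity_pos hN hx.1.le)).ne'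
end

section
/- The constants Λ_N = Θ(1/N)/ln(1+1/N), where Θ(x) = ∫_0^x ln(1+t)/t dt, are strictly decreasing in N: Λ_{N+1} < Λ_N for every positive integer N. More precisely, the function Λ(x) = Θ(x)/ln(1+x) satisfies Λ'(x) > 0 for all x ∈ (0,1). -/
open Filter Set

/-- The function `Λ(x) = Θ(x) / log(1+x)`; `Λ_N = Λ(1/N)`. -/
noncomputable def gaussLambdaFun (x : ℝ) : ℝ :=
  dilogTheta x / Real.log (1 + x)

/-- The continuous extension to `(-1, ∞)` of `t ↦ log (1 + t) / t`. -/
noncomputable def logQuotient : ℝ → ℝ :=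
  dslope (fun t => Real.log (1 + t)) 0

theorem logQuotient_of_ne {t : ℝ} (ht : t ≠ 0) :
    logQuotient t = Real.log (1 + t) / t := by
  simp [logQuotient, dslope_of_ne _ ht, slope_def_field]

theorem hasDerivAt_log_one_add {x : ℝ} (hx : -1 < x) :
    HasDerivAt (fun t => Real.log (1 + t)) (1 / (1 + x)) x :=
  ((hasDerivAt_id x).const_add 1).log (by simp; linarith)

theorem continuousOn_logQuotient : ContinuousOn logQuotient (Ioi (-1)) :=
  (continuousOn_dslope (Ioi_mem_nhds (by norm_num))).2
    ⟨fun _ hx => (hasDerivAt_log_one_add hx).continuousAt.continuousWithinAt,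
      (hasDerivAt_log_one_add (by norm_num)).differentiableAt⟩

theorem dilogTheta_eq_integral_logQuotient (x : ℝ) :
    dilogTheta x = ∫ t in (0:ℝ)..x, logQuotient t := by
  refine intervalIntegral.integral_congr_ae ?_
  filter_upwards [MeasureTheory.Measure.ae_ne MeasureTheory.volume (0:ℝ)] with t ht _
  exact (logQuotient_of_ne ht).symm

theorem hasDerivAt_dilogTheta {x : ℝ} (hx : -1 < x) :
    HasDerivAt dilogTheta (logQuotient x) x := by
  rw [funext dilogTheta_eq_integral_logQuotient]
  refine intervalIntegral.integral_hasDerivAt_right ?_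
    (continuousOn_logQuotient.stronglyMeasurableAtFilter isOpen_Ioi x hx)
    (continuousOn_logQuotient.continuousAt (Ioi_mem_nhds hx))
  refine (continuousOn_logQuotient.mono fun t ht => ?_).intervalIntegrable
  exact lt_of_lt_of_le (lt_min (by norm_num) hx) ht.1

theorem dilogTheta_lt {x : ℝ} (hx : 0 < x) :
    dilogTheta x < (1 + x) * Real.log (1 + x) ^ 2 / x := by
  have hmono : StrictMonoOn
      (fun t => (1 + t) * Real.log (1 + t) * logQuotient t - dilogTheta t) (Ici 0) := by
    refine strictMonoOn_of_deriv_pos (convex_Ici 0) ?_ ?_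
    · intro t ht
      have ht' : -1 < t := lt_of_lt_of_le (by norm_num) ht
      exact ((((continuousAt_const.add continuousAt_id).mul
        (hasDerivAt_log_one_add ht').continuousAt).mul
        (continuousOn_logQuotient.continuousAt (Ioi_mem_nhds ht'))).sub
        (hasDerivAt_dilogTheta ht').continuousAt).continuousWithinAt
    · intro t ht
      rw [interior_Ici] at ht
      have ht0 : 0 < t := ht
      have hlog : HasDerivAt (fun t => Real.log (1 + t)) (1 / (1 + t)) t :=
        hasDerivAt_log_one_add (by linarith)
      have hquot : HasDerivAt logQuotient
          ((1 / (1 + t) * t - Real.log (1 + t) * 1) / t ^ 2) t := by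
        refine (hlog.div (hasDerivAt_id t) ht0.ne').congr_of_eventuallyEq ?_
        filter_upwards [eventually_ne_nhds ht0.ne'] with s hs
        exact logQuotient_of_ne hs
      have hderiv := ((((hasDerivAt_id t).const_add 1).mul hlog).mul hquot).sub
        (hasDerivAt_dilogTheta (show -1 < t by linarith))
      have hpos : 0 < Real.log (1 + t) := Real.log_pos (by linarith)
      have hlt : Real.log (1 + t) < t := by
        have := Real.log_lt_sub_one_of_pos (show 0 < 1 + t by linarith) (by linarith)
        linarith
      have heq : deriv (fun t => (1 + t) * Real.log (1 + t) * logQuotient t - dilogTheta t) t =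
          Real.log (1 + t) * (t - Real.log (1 + t)) / t ^ 2 := by
        refine hderiv.deriv.trans ?_
        simp only [Pi.mul_apply, id_eq, logQuotient_of_ne ht0.ne']
        field_simp
        ring
      rw [heq]
      exact div_pos (mul_pos hpos (sub_pos.2 hlt)) (by positivity)
  have h := hmono self_mem_Ici hx.le hx
  simp only [logQuotient_of_ne hx.ne', dilogTheta, intervalIntegral.integral_same, add_zero,
    Real.log_one, mul_zero, zero_mul, sub_zero, sub_pos] at h
  calc dilogTheta x < (1 + x) * Real.log (1 + x) * (Real.log (1 + x) / x) := h
    _ = _ := by ring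

theorem deriv_gaussLambdaFun_pos {x : ℝ} (hx : 0 < x) : 0 < deriv gaussLambdaFun x := by
  have hpos : 0 < Real.log (1 + x) := Real.log_pos (by linarith)
  have hderiv : HasDerivAt gaussLambdaFun _ x :=
    (hasDerivAt_dilogTheta (show -1 < x by linarith)).div
      (hasDerivAt_log_one_add (by linarith)) hpos.ne'
  rw [hderiv.deriv, logQuotient_of_ne hx.ne']
  refine div_pos ?_ (by positivity)
  have h : dilogTheta x / (1 + x) < (1 + x) * Real.log (1 + x) ^ 2 / x / (1 + x) :=
    div_lt_div_of_pos_right (dilogTheta_lt hx) (by linarith)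
  have heq : (1 + x) * Real.log (1 + x) ^ 2 / x / (1 + x) =
      Real.log (1 + x) / x * Real.log (1 + x) := by
    field_simp
  rw [heq] at h
  rw [mul_one_div]
  exact sub_pos.2 h

theorem strictMonoOn_gaussLambdaFun : StrictMonoOn gaussLambdaFun (Ioi 0) := by
  refine strictMonoOn_of_deriv_pos (convex_Ioi 0) (fun x hx => ?_) fun x hx => ?_
  · exact (differentiableAt_of_deriv_ne_zero
      (deriv_gaussLambdaFun_pos hx).ne').continuousAt.continuousWithinAt
  · rw [interior_Ioi] at hx
    exact deriv_gaussLambdaFun_pos hx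

/-- `Λ_N = Λ(1/N)` is strictly decreasing in `N`; more precisely,
`Λ'(x) > 0` for all `x ∈ (0,1)`. -/
theorem gaussLambda_strict_anti :
    (∀ N : ℕ, 0 < N →
        gaussLambdaFun (1 / ((N : ℝ) + 1)) < gaussLambdaFun (1 / (N : ℝ))) ∧
    (∀ x ∈ Set.Ioo (0:ℝ) 1, 0 < deriv gaussLambdaFun x) := by
  refine ⟨fun N hN => ?_, fun x hx => deriv_gaussLambdaFun_pos hx.1⟩
  have hN' : (0:ℝ) < N := Nat.cast_pos.2 hN
  exact strictMonoOn_gaussLambdaFun (show (0:ℝ) < 1 / (N + 1) by positivity)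
    (show (0:ℝ) < 1 / N by positivity) (one_div_lt_one_div_of_lt hN' (lt_add_one _))
end

section
/- For every positive integer N and every x ∈ [0,1), the lower Lyapunov exponent of T_N at x satisfies λ_N^−(x) := liminf_{n→∞} (1/n) Σ_{k=0}^{n-1} ln|T_N'(T_N^k(x))| ≥ 2 ln((√(N+4) + √N)/2), i.e. liminf_{n→∞} (1/n) Σ_{k=0}^{n-1} ln(N/(T_N^k(x))²) ≥ 2 ln((√(N+4) + √N)/2). -/
open Filter Set

lemma gaussT_mem_Ico (N : ℕ) (x : ℝ) : gaussT N x ∈ Set.Ico (0 : ℝ) 1 := by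
  unfold gaussT
  split_ifs
  · simp
  · exact ⟨Int.fract_nonneg _, Int.fract_lt_one _⟩

lemma iterate_gaussT_mem_Ico (N : ℕ) {x : ℝ} (hx : x ∈ Set.Ico (0 : ℝ) 1) (k : ℕ) :
    (gaussT N)^[k] x ∈ Set.Ico (0 : ℝ) 1 := by
  cases k with
  | zero => exact hx
  | succ k => rw [Function.iterate_succ_apply']; exact gaussT_mem_Ico N _

/-- All digits of the expansion of a point of `(0,1)` are at least `N`. -/
lemma mul_gaussT_add_le (N : ℕ) {x : ℝ} (hx0 : 0 < x) (hx1 : x < 1) :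
    x * (gaussT N x + N) ≤ N := by
  have hfloor : (N : ℤ) ≤ ⌊(N : ℝ) / x⌋ := by
    rw [Int.le_floor, le_div_iff₀ hx0, Int.cast_natCast]
    exact mul_le_of_le_one_right N.cast_nonneg hx1.le
  have hfloor' : (N : ℝ) ≤ ⌊(N : ℝ) / x⌋ := by exact_mod_cast hfloor
  have hT : gaussT N x + N ≤ N / x := by
    rw [gaussT, if_neg hx0.ne', Int.fract]
    linarith
  calc x * (gaussT N x + N) ≤ x * (N / x) := by gcongr
    _ = N := mul_div_cancel₀ _ hx0.ne'

/-- The logarithmic derivative of `T_N` dominates `2 log φ` up to the coboundary of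
`x ↦ 2 log (x + √N φ)`, where `φ ^ 2 = 1 + √N φ`. -/
lemma log_add_coboundary_le {N : ℕ} (hN : 0 < N) {φ : ℝ} (hφ : 0 < φ)
    (hφN : φ ^ 2 = 1 + √(N : ℝ) * φ) {x : ℝ} (hx0 : 0 < x) (hx1 : x < 1) :
    2 * Real.log φ + (2 * Real.log (gaussT N x + √(N : ℝ) * φ)
      - 2 * Real.log (x + √(N : ℝ) * φ)) ≤ Real.log ((N : ℝ) / x ^ 2) := by
  have hy := (gaussT_mem_Ico N x).1
  have hT := mul_gaussT_add_le N hx0 hx1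
  set y := gaussT N x
  have hs : 0 < √(N : ℝ) := Real.sqrt_pos.2 (by exact_mod_cast hN)
  have hss : √(N : ℝ) ^ 2 = N := Real.sq_sqrt N.cast_nonneg
  set s := √(N : ℝ)
  have key : x * φ * (y + s * φ) ≤ s * (x + s * φ) := by
    rw [← hss] at hT
    calc x * φ * (y + s * φ) = φ * (x * (y + s ^ 2)) + s * x := by
          linear_combination x * s * hφN
      _ ≤ φ * s ^ 2 + s * x := by gcongr
      _ = s * (x + s * φ) := by ring
  have hlog := Real.log_le_log (by positivity) key
  rw [Real.log_mul (by positivity) (by positivity), Real.log_mul hx0.ne' hφ.ne',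
    Real.log_mul hs.ne' (by positivity)] at hlog
  rw [← hss, ← div_pow, Real.log_pow, Real.log_div hs.ne' hx0.ne']
  push_cast
  linarith

/-- For every `x ∈ [0,1)`, the lower Lyapunov exponent of `T_N` at `x`,
`λ_N^-(x) = liminf (1/n) ∑_{k<n} log(N / (T_N^[k] x)²)` (with the convention that a
term is `+∞` when `T_N^[k] x = 0`), is at least `2 log((√(N+4) + √N)/2)`. -/
theorem gaussT_lower_lyapunov_bound (N : ℕ) (hN : 0 < N)
    (x : ℝ) (hx : x ∈ Set.Ico (0:ℝ) 1) :
    ((2 * Real.log ((Real.sqrt ((N : ℝ) + 4) + Real.sqrt (N : ℝ)) / 2) : ℝ) : EReal) ≤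
      Filter.liminf (fun n : ℕ =>
          (((n : ℝ)⁻¹ : ℝ) : EReal) *
            ∑ k ∈ Finset.range n,
              (if (gaussT N)^[k] x = 0 then (⊤ : EReal)
               else ((Real.log ((N : ℝ) / ((gaussT N)^[k] x) ^ 2) : ℝ) : EReal)))
        atTop := by
  have hs : 0 < √(N : ℝ) := Real.sqrt_pos.2 (by exact_mod_cast hN)
  have hφ : 0 < (√((N : ℝ) + 4) + √(N : ℝ)) / 2 := by positivity
  have hφN : ((√((N : ℝ) + 4) + √(N : ℝ)) / 2) ^ 2
      = 1 + √(N : ℝ) * ((√((N : ℝ) + 4) + √(N : ℝ)) / 2) := by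
    have h1 : √(N : ℝ) ^ 2 = N := Real.sq_sqrt N.cast_nonneg
    have h2 : √((N : ℝ) + 4) ^ 2 = N + 4 := Real.sq_sqrt (by positivity)
    linear_combination (h2 - h1) / 4
  generalize (√((N : ℝ) + 4) + √(N : ℝ)) / 2 = φ at hφ hφN ⊢
  set g : ℝ → ℝ := fun y => 2 * Real.log (y + √(N : ℝ) * φ) with hg
  have hsum (n : ℕ) : ((n * (2 * Real.log φ) + (g ((gaussT N)^[n] x) - g x) : ℝ) : EReal) ≤
      ∑ k ∈ Finset.range n,
        (if (gaussT N)^[k] x = 0 then (⊤ : EReal)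
          else ((Real.log ((N : ℝ) / ((gaussT N)^[k] x) ^ 2) : ℝ) : EReal)) := by
    induction n with
    | zero => simp
    | succ n ih =>
      have hterm : ((2 * Real.log φ + (g ((gaussT N)^[n + 1] x) - g ((gaussT N)^[n] x)) : ℝ)
          : EReal) ≤ if (gaussT N)^[n] x = 0 then (⊤ : EReal)
            else ((Real.log ((N : ℝ) / ((gaussT N)^[n] x) ^ 2) : ℝ) : EReal) := by
        split_ifs with h
        · exact le_top
        · have hmem := iterate_gaussT_mem_Ico N hx n
          rw [Function.iterate_succ_apply', EReal.coe_le_coe_iff]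
          exact log_add_coboundary_le hN hφ hφN (hmem.1.lt_of_ne' h) hmem.2
      rw [Finset.sum_range_succ]
      refine le_trans (le_of_eq ?_) (add_le_add ih hterm)
      rw [← EReal.coe_add]
      congr 1
      push_cast
      ring
  have hbound (n : ℕ) : g 0 ≤ g ((gaussT N)^[n] x) := by
    have := (iterate_gaussT_mem_Ico N hx n).1
    simp only [hg]
    gcongr
  have hlim : Tendsto (fun n : ℕ => 2 * Real.log φ + (n : ℝ)⁻¹ * (g 0 - g x)) atTop
      (nhds (2 * Real.log φ)) := by
    simpa using ((tendsto_inv_atTop_nhds_zero_nat (𝕜 := ℝ)).mul_const (g 0 - g x)).const_add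
      (2 * Real.log φ)
  rw [← ((continuous_coe_real_ereal.tendsto _).comp hlim).liminf_eq]
  refine liminf_le_liminf ?_
  filter_upwards [eventually_gt_atTop 0] with n hn
  have hn' : (0 : ℝ) < n := by exact_mod_cast hn
  refine le_trans ?_ (mul_le_mul_of_nonneg_left (hsum n)
    (EReal.coe_nonneg.2 (inv_nonneg.2 hn'.le)))
  rw [Function.comp_apply, ← EReal.coe_mul, EReal.coe_le_coe_iff, mul_add,
    inv_mul_cancel_left₀ hn'.ne']
  gcongr
  exact hbound n
end
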